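/- The group algebra ℂH is Morita equivalent to the twisted groupoid algebra C(Ĝ⋊Q, c). -/

import Mathlib

noncomputable section
/-- A representation is irreducible if the space is nonzero and has no nontrivial invariant
subspace. -/
def IsIrredRep {K V : Type} [Group K] [AddCommGroup V] [Module ℂ V]
    (ρ : Representation ℂ K V) : Prop :=
  Nontrivial V ∧
    ∀ W : Submodule ℂ V, (∀ (k : K), ∀ v ∈ W, ρ k v ∈ W) → W = ⊥ ∨ W = ⊤

/-- Two representations are isomorphic if there is an intertwining linear equivalence. -/
def RepIso {K V W : Type} [Group K] [AddCommGroup V] [Module ℂ V]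
    [AddCommGroup W] [Module ℂ W]
    (ρ : Representation ℂ K V) (σ : Representation ℂ K W) : Prop :=
  ∃ e : V ≃ₗ[ℂ] W, ∀ (k : K) (v : V), e (ρ k v) = σ k (e v)

/-- The representation `g ↦ ρ (h·g·h⁻¹)` of the (normal) kernel of `j`, for `h : H`. -/
def conjRep {H Q : Type} [Group H] [Group Q] (j : H →* Q) {V : Type}
    [AddCommGroup V] [Module ℂ V] (ρ : Representation ℂ j.ker V) (h : H) :
    Representation ℂ j.ker V :=
  MonoidHom.comp ρ (MulAut.conjNormal h).toMonoidHom

/-- `τ(q₁,q₂) := s q₁ * s q₂ * (s (q₁ q₂))⁻¹`, an element of `G = ker j`. -/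
def tau {H Q : Type} [Group H] [Group Q] (j : H →* Q) (s : Q → H)
    (hs : ∀ q, j (s q) = q) (q₁ q₂ : Q) : j.ker :=
  ⟨s q₁ * s q₂ * (s (q₁ * q₂))⁻¹, by simp [MonoidHom.mem_ker, hs, mul_assoc]⟩

/-- Transport along an equality of indices, as a linear map. -/
def castHom {Ghat : Type} (V : Ghat → Type) [∀ r, AddCommGroup (V r)]
    [∀ r, Module ℂ (V r)] {a b : Ghat} (h : a = b) : V a →ₗ[ℂ] V b where
  toFun v := cast (congrArg V h) v
  map_add' := by subst h; intros; rfl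
  map_smul' := by subst h; intros; rfl

/-- Two ℂ-algebras are Morita equivalent if their categories of left modules are
ℂ-linearly equivalent. -/
def MoritaEquiv (A B : Type) [Ring A] [Ring B] [Algebra ℂ A] [Algebra ℂ B] : Prop :=
  ∃ e : ModuleCat.{0} A ≌ ModuleCat.{0} B, ∃ _h : e.functor.Additive, e.functor.Linear ℂ

/-- The underlying ℂ-vector space of the twisted groupoid algebra `C(Ĝ⋊Q, c)`:
functions on `Ĝ × Q`, with basis the indicator functions `([ρ], q)`. -/
structure GrpdAlg (Ghat Q : Type) where
  /-- the coefficient of the element at the basis vector `([ρ], q)` -/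
  coef : Ghat → Q → ℂ


open CategoryTheory

namespace CornerMorita

variable {A B : Type} [Ring A] [Ring B] [Algebra ℂ A] [Algebra ℂ B] (ι : B →ₙₐ[ℂ] A)

/-- The part `ι 1 • W` of an `A`-module `W`, for a non-unital homomorphism `ι : B → A`. -/
def fixedPart (W : Type) [AddCommGroup W] [Module A W] : AddSubgroup W where
  carrier := {w | ι 1 • w = w}
  add_mem' {a b} ha hb := by
    simp only [Set.mem_ofPred_eq] at *
    rw [smul_add, ha, hb]
  zero_mem' := smul_zero _
  neg_mem' {a} ha := by
    simp only [Set.mem_ofPred_eq] at *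
    rw [smul_neg, ha]

variable {W W' : Type} [AddCommGroup W] [Module A W] [AddCommGroup W'] [Module A W']

theorem mem_fixedPart {w : W} : w ∈ fixedPart ι W ↔ ι 1 • w = w := Iff.rfl

instance : SMul B (fixedPart ι W) where
  smul b w := ⟨ι b • (w : W), by rw [mem_fixedPart, smul_smul, ← map_mul, one_mul]⟩

@[simp]
theorem coe_smul (b : B) (w : fixedPart ι W) : ((b • w : fixedPart ι W) : W) = ι b • (w : W) := rfl

instance : Module B (fixedPart ι W) where
  one_smul w := Subtype.ext w.2
  mul_smul a b w := Subtype.ext <| by simp [mul_smul]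
  smul_zero a := Subtype.ext <| by simp
  smul_add a x y := Subtype.ext <| by simp
  add_smul a b x := Subtype.ext <| by simp [add_smul]
  zero_smul x := Subtype.ext <| by simp

/-- The restriction of an `A`-linear map to the fixed parts. -/
def fixedPartMap (f : W →ₗ[A] W') : fixedPart ι W →ₗ[B] fixedPart ι W' where
  toFun w := ⟨f w, by rw [mem_fixedPart, ← map_smul, w.2]⟩
  map_add' x y := Subtype.ext <| by simp
  map_smul' b x := Subtype.ext <| by simp

/-- The functor `W ↦ ι 1 • W`. -/
def functor : ModuleCat.{0} A ⥤ ModuleCat.{0} B where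
  obj W := ModuleCat.of B (fixedPart ι W)
  map f := ModuleCat.ofHom (fixedPartMap ι f.hom)

instance : (functor ι).Additive where
  map_add := rfl

instance : (functor ι).Linear ℂ where
  map_smul {X Y} f r := by
    refine ModuleCat.hom_ext (LinearMap.ext fun (w : fixedPart ι X) => Subtype.ext ?_)
    change algebraMap ℂ A r • f.hom (w : X) = ι (algebraMap ℂ B r) • f.hom (w : X)
    rw [Algebra.algebraMap_eq_smul_one r (A := B), map_smul, ← smul_one_mul r (ι 1), mul_smul,
      ← map_smul f.hom (ι 1), (mem_fixedPart ι).1 w.2, Algebra.algebraMap_eq_smul_one]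

/-- The `A`-module coinduced from a `B`-module `M` along `ι`. -/
def coinduced (M : Type) [AddCommGroup M] [Module B M] : AddSubgroup (A →+ M) where
  carrier := {f | ∀ b a, f (ι b * a) = b • f a}
  add_mem' {f g} hf hg b a := by simp [hf b a, hg b a]
  zero_mem' b a := by simp
  neg_mem' {f} hf b a := by simp [hf b a]

section

variable {M : Type} [AddCommGroup M] [Module B M]

instance : SMul A (coinduced ι M) where
  smul a f := ⟨(f : A →+ M).comp (AddMonoidHom.mulRight a), fun b x => by
    simpa [mul_assoc] using f.2 b (x * a)⟩

theorem coe_smul_apply (a : A) (f : coinduced ι M) (x : A) :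
    ((a • f : coinduced ι M) : A →+ M) x = (f : A →+ M) (x * a) := rfl

instance : Module A (coinduced ι M) where
  one_smul f := Subtype.ext <| by ext x; simp [coe_smul_apply]
  mul_smul a b f := Subtype.ext <| by ext x; simp [coe_smul_apply, mul_assoc]
  smul_zero a := Subtype.ext <| by ext x; simp [coe_smul_apply]
  smul_add a f g := Subtype.ext <| by ext x; simp [coe_smul_apply]
  add_smul a b f := Subtype.ext <| by ext x; simp [coe_smul_apply, mul_add]
  zero_smul f := Subtype.ext <| by ext x; simp [coe_smul_apply]

end

/-- If `ι` identifies `B` with the corner `e A e`, `e = ι 1`, and `A e A = A`, then `A` and `B`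
are Morita equivalent. -/
theorem moritaEquiv (hinj : Function.Injective ι) (hcorner : ∀ a, ∃ b, ι b = ι 1 * a * ι 1)
    {n : Type} [Fintype n] (l r : n → A) (hfull : ∑ i, l i * ι 1 * r i = 1) :
    MoritaEquiv A B := by
  have hfix {W : Type} [AddCommGroup W] [Module A W] (w : W) : ι 1 • w ∈ fixedPart ι W := by
    rw [mem_fixedPart, smul_smul, ← map_mul, one_mul]
  have hsum {W : Type} [AddCommGroup W] [Module A W] (w : W) : ∑ i, l i • ι 1 • r i • w = w := by
    simp_rw [smul_smul, ← Finset.sum_smul, ← mul_assoc, hfull, one_smul]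
  have : (functor ι).Faithful := ⟨fun {X Y f g} h => by
    ext w
    have hfg (w : fixedPart ι X) : f.hom (w : X) = g.hom (w : X) :=
      congrArg Subtype.val (DFunLike.congr_fun (congrArg ModuleCat.Hom.hom h) w)
    have h2 (w : X) : f.hom (ι 1 • w) = g.hom (ι 1 • w) := hfg ⟨_, hfix w⟩
    rw [← hsum w]
    simp only [map_sum, map_smul, h2]⟩
  have : (functor ι).Full := ⟨fun {X Y} g => by
    let g' : fixedPart ι X →ₗ[B] fixedPart ι Y := g.hom
    let φ : X →+ Y := AddMonoidHom.mk' (fun w => (g' ⟨ι 1 • w, hfix w⟩ : Y)) fun x y => by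
      rw [← AddSubgroup.coe_add, ← map_add]
      congr 2
      exact Subtype.ext (smul_add _ _ _)
    have hφ (b : B) (w : X) : φ (ι b • w) = ι b • φ w := by
      change ((g' _ : fixedPart ι Y) : Y) = ι b • ((g' _ : fixedPart ι Y) : Y)
      rw [← coe_smul, ← map_smul]
      congr 2
      exact Subtype.ext (by simp [smul_smul, ← map_mul])
    have hφ1 (w : X) : φ (ι 1 • w) = φ w := by
      change ((g' _ : fixedPart ι Y) : Y) = ((g' _ : fixedPart ι Y) : Y)
      congr 2
      exact Subtype.ext (by simp [smul_smul, ← map_mul])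
    have hφe (a : A) (w : X) : φ (a • ι 1 • w) = ι 1 • a • φ w := by
      obtain ⟨b, hb⟩ := hcorner a
      rw [← hφ1, smul_smul, smul_smul, ← hb, hφ, hb, mul_smul, mul_smul, ← hφ, hφ1]
    have hφe' (a b c : A) (w : X) : φ (a • b • c • ι 1 • w) = ι 1 • a • b • c • φ w := by
      simpa only [mul_smul] using hφe (a * b * c) w
    let f : X →ₗ[A] Y :=
      { toFun w := ∑ i, l i • φ (r i • w)
        map_add' x y := by simp [Finset.sum_add_distrib]
        map_smul' a w := by
          simp only [RingHom.id_apply]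
          calc ∑ i, l i • φ (r i • a • w)
              = ∑ i, l i • φ (r i • a • ∑ j, l j • ι 1 • r j • w) := by rw [hsum]
            _ = ∑ j, ∑ i, l i • ι 1 • r i • a • l j • φ (r j • w) := by
              rw [Finset.sum_comm]
              simp only [Finset.smul_sum, map_sum, hφe']
            _ = a • ∑ j, l j • φ (r j • w) := by simp only [hsum, Finset.smul_sum] }
    refine ⟨ModuleCat.ofHom f, ?_⟩
    refine ModuleCat.hom_ext (LinearMap.ext fun (w : fixedPart ι X) => Subtype.ext ?_)
    change ∑ i, l i • φ (r i • (w : X)) = (g' w : Y)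
    rw [← (mem_fixedPart ι).1 w.2]
    simp only [hφe, hsum]
    change ((g' _ : fixedPart ι Y) : Y) = _
    congr 2
    exact Subtype.ext w.2⟩
  have : (functor ι).EssSurj := ⟨fun M => by
    choose c hc using hcorner
    have hc_add (x y : A) : c (x + y) = c x + c y := hinj <| by
      simp [hc, mul_add, add_mul]
    have hc_mul (b : B) (x : A) : c (ι b * x) = b * c x := hinj <| by
      rw [map_mul, hc, hc, ← mul_assoc, ← mul_assoc, ← mul_assoc, ← map_mul, ← map_mul, one_mul,
        mul_one]
    have hc_one : c 1 = 1 := hinj <| by rw [hc, mul_one, ← map_mul, one_mul]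
    have hc_mul_one (x : A) : c (x * ι 1) = c x := hinj <| by
      rw [hc, hc, mul_assoc, mul_assoc, ← map_mul, one_mul, ← mul_assoc]
    let f : fixedPart ι (coinduced ι M) ≃ₗ[B] M :=
      { toFun f := (f : A →+ M) 1
        map_add' _ _ := rfl
        map_smul' b f := by
          simp only [coe_smul, coe_smul_apply, RingHom.id_apply]
          rw [← f.1.2 b 1, one_mul, mul_one]
        invFun m := ⟨⟨AddMonoidHom.mk' (fun a => c a • m) fun x y => by
            rw [hc_add, add_smul], fun b a => by simp [hc_mul, mul_smul]⟩, by
          rw [mem_fixedPart]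
          refine Subtype.ext (AddMonoidHom.ext fun x => ?_)
          simp [coe_smul_apply, hc_mul_one]⟩
        left_inv f := by
          have hf (x : A) : (f : A →+ M) (x * ι 1) = (f : A →+ M) x :=
            DFunLike.congr_fun (congrArg Subtype.val f.2) x
          refine Subtype.ext (Subtype.ext (AddMonoidHom.ext fun x => ?_))
          change c x • (f : A →+ M) 1 = (f : A →+ M) x
          rw [← f.1.2, mul_one, hc, hf, f.1.2, one_smul]
        right_inv m := by simp [hc_one] }
    exact ⟨ModuleCat.of A (coinduced ι M), ⟨f.toModuleIso⟩⟩⟩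
  have : (functor ι).IsEquivalence := {}
  exact ⟨(functor ι).asEquivalence, inferInstanceAs (functor ι).Additive,
    inferInstanceAs ((functor ι).Linear ℂ)⟩

end CornerMorita

open MonoidAlgebra Representation
section
variable {K : Type} [Group K]

theorem apply_asAlgebraHom {V W : Type} [AddCommGroup V] [Module ℂ V] [AddCommGroup W] [Module ℂ W]
    {ρ : Representation ℂ K V} {σ : Representation ℂ K W} (e : V →ₗ[ℂ] W)
    (he : ∀ g v, e (ρ g v) = σ g (e v)) (a : MonoidAlgebra ℂ K) (v : V) :
    e (ρ.asAlgebraHom a v) = σ.asAlgebraHom a (e v) := by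
  induction a using MonoidAlgebra.induction_on with
  | of g => rw [asAlgebraHom_of, asAlgebraHom_of, he]
  | add a b ha hb => simp [ha, hb]
  | smul t a ha => simp [ha]

theorem IsIrredRep.isSimpleModule {V : Type} [AddCommGroup V] [Module ℂ V]
    {ρ : Representation ℂ K V} (h : IsIrredRep ρ) :
    IsSimpleModule (MonoidAlgebra ℂ K) ρ.asModule := by
  rw [isSimpleModule_iff]
  have : Nontrivial ρ.asModule := h.1
  refine { eq_bot_or_eq_top := fun N => ?_ }
  let W : Submodule ℂ V :=
    { carrier := {v | ρ.asModuleEquiv.symm v ∈ N}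
      add_mem' := fun ha hb => N.add_mem ha hb
      zero_mem' := N.zero_mem
      smul_mem' := fun t v hv => by
        simpa only [← asModuleEquiv_symm_map_smul] using!
          N.smul_mem (algebraMap ℂ (MonoidAlgebra ℂ K) t)
            (show ρ.asModuleEquiv.symm v ∈ N from hv) }
  have hW : W = ⊥ ∨ W = ⊤ := h.2 W fun k v hv => by
    simpa only [← asModuleEquiv_symm_map_rho] using!
      N.smul_mem (MonoidAlgebra.of ℂ K k) (show ρ.asModuleEquiv.symm v ∈ N from hv)
  refine hW.imp (fun h => ?_) fun h => ?_
  · exact (Submodule.eq_bot_iff _).2 fun x hx => (Submodule.eq_bot_iff _).1 h x hx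
  · exact Submodule.eq_top_iff'.2 fun x => Submodule.eq_top_iff'.1 h x

theorem RepIso.of_asModule {V W : Type} [AddCommGroup V] [Module ℂ V] [AddCommGroup W] [Module ℂ W]
    {ρ : Representation ℂ K V} {σ : Representation ℂ K W}
    (e : ρ.asModule ≃ₗ[MonoidAlgebra ℂ K] σ.asModule) : RepIso ρ σ := by
  refine ⟨ρ.asModuleEquiv.symm ≪≫ₗ e.restrictScalars ℂ ≪≫ₗ σ.asModuleEquiv, fun k v => ?_⟩
  change σ.asModuleEquiv (e (ρ.asModuleEquiv.symm (ρ k v))) =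
    σ k (σ.asModuleEquiv (e (ρ.asModuleEquiv.symm v)))
  rw [asModuleEquiv_symm_map_rho, map_smul, asModuleEquiv_map_smul, asAlgebraHom_of]

theorem isIrredRep_ofModule' {N : Type} [AddCommGroup N] [Module ℂ N]
    [Module (MonoidAlgebra ℂ K) N] [IsScalarTower ℂ (MonoidAlgebra ℂ K) N]
    [IsSimpleModule (MonoidAlgebra ℂ K) N] : IsIrredRep (ofModule' (k := ℂ) (G := K) N) := by
  refine ⟨IsSimpleModule.nontrivial (MonoidAlgebra ℂ K) N, fun W hW => ?_⟩
  let W' : Submodule (MonoidAlgebra ℂ K) N :=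
    { W with
      smul_mem' := fun a v hv => by
        induction a using MonoidAlgebra.induction_on with
        | of g => exact hW g v hv
        | add a b ha hb => rw [add_smul]; exact W.add_mem ha hb
        | smul t a ha => rw [smul_assoc]; exact W.smul_mem t ha }
  refine (eq_bot_or_eq_top W').imp (fun h => ?_) fun h => ?_
  · exact (Submodule.eq_bot_iff _).2 fun x hx => (Submodule.eq_bot_iff _).1 h x hx
  · exact Submodule.eq_top_iff'.2 fun x => Submodule.eq_top_iff'.1 h x

variable [Finite K] {I : Type} {V : I → Type} [∀ r, AddCommGroup (V r)] [∀ r, Module ℂ (V r)]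
  {ρ : ∀ r, Representation ℂ K (V r)}

theorem eq_zero_of_asAlgebraHom_eq_zero
    (hcomplete : ∀ (W : Type) [AddCommGroup W] [Module ℂ W] [FiniteDimensional ℂ W]
      (σ : Representation ℂ K W), IsIrredRep σ → ∃ r, RepIso σ (ρ r))
    {a : MonoidAlgebra ℂ K} (ha : ∀ r, (ρ r).asAlgebraHom a = 0) : a = 0 := by
  have : NeZero (Nat.card K : ℂ) := ⟨Nat.cast_ne_zero.2 Nat.card_pos.ne'⟩
  have h1 : (1 : MonoidAlgebra ℂ K) ∈
      sSup {m : Submodule (MonoidAlgebra ℂ K) (MonoidAlgebra ℂ K) |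
        IsSimpleModule (MonoidAlgebra ℂ K) m} := by
    rw [IsSemisimpleModule.sSup_simples_eq_top]; trivial
  rw [sSup_eq_iSup'] at h1
  rw [← mul_one a]
  refine Submodule.iSup_induction _ (motive := fun x => a * x = 0) h1 ?_ (mul_zero a)
    fun x y hx hy => by rw [mul_add, hx, hy, add_zero]
  rintro ⟨N, hN⟩ x hx
  have : IsSimpleModule (MonoidAlgebra ℂ K) N := hN
  have : FiniteDimensional ℂ N :=
    FiniteDimensional.of_injective (N.subtype.restrictScalars ℂ) N.subtype_injective
  obtain ⟨r, e, he⟩ := hcomplete N _ isIrredRep_ofModule'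
  have he' (b : MonoidAlgebra ℂ K) (n : N) : e (b • n) = (ρ r).asAlgebraHom b (e n) := by
    induction b using MonoidAlgebra.induction_on with
    | of g => rw [asAlgebraHom_of]; exact he g n
    | add a b ha hb => simp [add_smul, ha, hb]
    | smul t a ha => simp [ha]
  have : a • (⟨x, hx⟩ : N) = 0 := e.injective <| by rw [he', ha]; simp
  exact congrArg Subtype.val this

theorem exists_asAlgebraHom_eq [Finite I] [∀ r, FiniteDimensional ℂ (V r)]
    (hirr : ∀ r, IsIrredRep (ρ r))
    (hdist : ∀ r r', RepIso (ρ r) (ρ r') → r = r') (F : ∀ r, V r →ₗ[ℂ] V r) :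
    ∃ a : MonoidAlgebra ℂ K, ∀ r, (ρ r).asAlgebraHom a = F r := by
  classical
  have : NeZero (Nat.card K : ℂ) := ⟨Nat.cast_ne_zero.2 Nat.card_pos.ne'⟩
  have := Fintype.ofFinite I
  let R := MonoidAlgebra ℂ K
  let M := ∀ r, (ρ r).asModule
  have hs (r) : IsSimpleModule R (ρ r).asModule := (hirr r).isSimpleModule
  have hscal (e : Module.End R M) : ∃ t : I → ℂ, ∀ m r, e m r = t r • m r := by
    have h1 (r : I) : ∃ t : ℂ, ∀ v, e (Pi.single r v) r = t • v := by
      obtain ⟨t, ht⟩ := (IsSimpleModule.algebraMap_end_bijective_of_isAlgClosed ℂ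
        (A := R) (V := (ρ r).asModule)).2 (LinearMap.proj r ∘ₗ e ∘ₗ
          LinearMap.single R (fun r => (ρ r).asModule) r)
      exact ⟨t, fun v => (LinearMap.congr_fun ht v).symm⟩
    have h2 (r r' : I) (h : r ≠ r') (v) : e (Pi.single r v) r' = 0 := by
      let f : (ρ r).asModule →ₗ[R] (ρ r').asModule :=
        LinearMap.proj r' ∘ₗ e ∘ₗ LinearMap.single R (fun r => (ρ r).asModule) r
      rcases LinearMap.bijective_or_eq_zero f with hf | hf
      · exact absurd (hdist _ _ (RepIso.of_asModule (LinearEquiv.ofBijective f hf))) h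
      · exact LinearMap.congr_fun hf v
    choose t ht using h1
    refine ⟨t, fun m r => ?_⟩
    conv_lhs => rw [← Finset.univ_sum_single m]
    rw [map_sum, Finset.sum_apply, Finset.sum_eq_single r (fun r' _ h => h2 r' r h _) (by simp), ht]
  let f : Module.End (Module.End R M) M :=
    { toFun m r := (ρ r).asModuleEquiv.symm (F r ((ρ r).asModuleEquiv (m r)))
      map_add' m m' := by
        ext r
        change (ρ r).asModuleEquiv.symm (F r ((ρ r).asModuleEquiv (m r + m' r))) = _
        rw [map_add, map_add, map_add]
        rfl
      map_smul' e m := by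
        obtain ⟨t, ht⟩ := hscal e
        ext r
        rw [RingHom.id_apply, Module.End.smul_def, Module.End.smul_def, ht, ht, map_smul, map_smul,
          map_smul] }
  let s : Finset M := Finset.univ.image
    fun x : (Σ r, Fin (Module.finrank ℂ (V r))) =>
      Pi.single x.1 ((ρ x.1).asModuleEquiv.symm (Module.finBasis ℂ (V x.1) x.2))
  obtain ⟨a, ha⟩ := jacobson_density f s
  refine ⟨a, fun r => (Module.finBasis ℂ (V r)).ext fun i => ?_⟩
  let b : (ρ r).asModule := (ρ r).asModuleEquiv.symm (Module.finBasis ℂ (V r) i)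
  have h : (ρ r).asModuleEquiv.symm (F r ((ρ r).asModuleEquiv ((Pi.single r b : M) r))) =
      a • (Pi.single r b : M) r :=
    congrFun (ha _ (Finset.mem_image_of_mem _
      (Finset.mem_univ (⟨r, i⟩ : Σ r, Fin (Module.finrank ℂ (V r)))))) r
  rw [Pi.single_eq_same] at h
  exact (asModuleEquiv_map_smul (ρ r) a b).symm.trans (congrArg (ρ r).asModuleEquiv h.symm)
end

/-- A choice, for every member of a family of representations and every rank one operator, of an
element of the group algebra acting by this operator on that member and by zero on the others,
where the family is jointly faithful. -/
structure RankOneSystem {K I : Type} [Group K] {V : I → Type} [∀ r, AddCommGroup (V r)]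
    [∀ r, Module ℂ (V r)] (ρ : ∀ r, Representation ℂ K (V r)) where
  /-- the element acting by `v ↦ η v • x` on `V r` -/
  elt : ∀ r, V r → Module.Dual ℂ (V r) → MonoidAlgebra ℂ K
  act_self : ∀ r x η v, (ρ r).asAlgebraHom (elt r x η) v = η v • x
  act_ne : ∀ r r' x η, r' ≠ r → (ρ r').asAlgebraHom (elt r x η) = 0
  faithful : ∀ a b, (∀ r, (ρ r).asAlgebraHom a = (ρ r).asAlgebraHom b) → a = b

namespace RankOneSystem

section

variable {K I : Type} [Group K] {V : I → Type} [∀ r, AddCommGroup (V r)] [∀ r, Module ℂ (V r)]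
  {ρ : ∀ r, Representation ℂ K (V r)}

theorem nonempty_of_irreducible [Finite K] [Finite I] [∀ r, FiniteDimensional ℂ (V r)]
    (hirr : ∀ r, IsIrredRep (ρ r)) (hdist : ∀ r r', RepIso (ρ r) (ρ r') → r = r')
    (hcomplete : ∀ (W : Type) [AddCommGroup W] [Module ℂ W] [FiniteDimensional ℂ W]
      (σ : Representation ℂ K W), IsIrredRep σ → ∃ r, RepIso σ (ρ r)) :
    Nonempty (RankOneSystem ρ) := by
  classical
  choose E hE using fun (r : I) (x : V r) (η : Module.Dual ℂ (V r)) =>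
    exists_asAlgebraHom_eq hirr hdist (Pi.single r (η.smulRight x))
  refine ⟨⟨E, fun r x η v => by simp [hE], fun r r' x η h => by simp [hE, h], fun a b h => ?_⟩⟩
  exact sub_eq_zero.1 (eq_zero_of_asAlgebraHom_eq_zero hcomplete fun r => by
    rw [map_sub, h, sub_self])

theorem ext_act (E : RankOneSystem ρ) {a b : MonoidAlgebra ℂ K}
    (h : ∀ r v, (ρ r).asAlgebraHom a v = (ρ r).asAlgebraHom b v) : a = b :=
  E.faithful a b fun r => LinearMap.ext (h r)

variable (E : RankOneSystem ρ)

theorem elt_mul (a : MonoidAlgebra ℂ K) (r : I) (x : V r) (η : Module.Dual ℂ (V r)) :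
    E.elt r x η * a = E.elt r x (η ∘ₗ (ρ r).asAlgebraHom a) := by
  refine E.ext_act fun r' v => ?_
  by_cases h : r' = r
  · subst h
    simp [E.act_self]
  · simp [E.act_ne _ _ _ _ h]

theorem smul_elt (t : ℂ) (r : I) (x : V r) (η : Module.Dual ℂ (V r)) :
    t • E.elt r x η = E.elt r x (t • η) := by
  refine E.ext_act fun r' v => ?_
  by_cases h : r' = r
  · subst h
    simp [E.act_self, mul_smul]
  · simp [E.act_ne _ _ _ _ h]

theorem elt_mul_elt (r : I) (x y : V r) (η θ : Module.Dual ℂ (V r)) :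
    E.elt r x η * E.elt r y θ = η y • E.elt r x θ := by
  refine E.ext_act fun r' v => ?_
  by_cases h : r' = r
  · subst h
    simp [E.act_self, smul_smul, mul_comm]
  · simp [E.act_ne _ _ _ _ h]

theorem elt_mul_elt_of_ne {r r' : I} (hr : r ≠ r') (x : V r) (y : V r') (η : Module.Dual ℂ (V r))
    (θ : Module.Dual ℂ (V r')) : E.elt r x η * E.elt r' y θ = 0 := by
  refine E.ext_act fun r'' v => ?_
  by_cases h : r'' = r
  · simp [E.act_ne r' r'' _ _ (h ▸ hr)]
  · simp [E.act_ne _ _ _ _ h]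

theorem sum_elt_basis [Fintype I] {n : I → Type} [∀ r, Fintype (n r)]
    (b : ∀ r, Module.Basis (n r) ℂ (V r)) :
    ∑ i : Σ r, n r, E.elt i.1 (b i.1 i.2) ((b i.1).coord i.2) = 1 := by
  classical
  refine E.ext_act fun r v => ?_
  rw [Fintype.sum_sigma, map_sum, Finset.sum_eq_single r]
  · simp [E.act_self, LinearMap.sum_apply, (b r).sum_repr]
  · intro r' _ h
    rw [map_sum]
    exact Finset.sum_eq_zero fun i _ => E.act_ne _ _ _ _ h.symm
  · simp

theorem eq_zero_of_sum_smul_elt_eq_zero [Fintype I] (t : I → ℂ) (x : ∀ r, V r)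
    (η : ∀ r, Module.Dual ℂ (V r)) (hx : ∀ r, x r ≠ 0) (hη : ∀ r, η r ≠ 0)
    (h : ∑ r, t r • E.elt r (x r) (η r) = 0) : t = 0 := by
  classical
  ext r
  obtain ⟨v, hv⟩ := DFunLike.ne_iff.1 (hη r)
  have h1 : (ρ r).asAlgebraHom (∑ r, t r • E.elt r (x r) (η r)) v = 0 := by simp [h]
  rw [map_sum, Finset.sum_eq_single r] at h1
  · simpa [E.act_self, hx r, show η r v ≠ 0 from hv] using h1
  · intro r' _ h
    simp [E.act_ne _ _ _ _ h.symm]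
  · simp

end

end RankOneSystem

section Extension

variable {H Q : Type} [Group H] [Group Q] (j : H →* Q)

/-- The inclusion of the group algebra of the kernel. -/
def kerIncl : MonoidAlgebra ℂ j.ker →ₐ[ℂ] MonoidAlgebra ℂ H :=
  MonoidAlgebra.mapDomainAlgHom ℂ ℂ j.ker.subtype

/-- Conjugation by `h` on the group algebra of the kernel. -/
def kerConj (h : H) : MonoidAlgebra ℂ j.ker →ₐ[ℂ] MonoidAlgebra ℂ j.ker :=
  MonoidAlgebra.mapDomainAlgHom ℂ ℂ (MulAut.conjNormal h).toMonoidHom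

theorem kerIncl_of (g : j.ker) : kerIncl j (of ℂ _ g) = of ℂ H g := by
  simp [kerIncl]

theorem kerConj_of (h : H) (g : j.ker) :
    kerConj j h (of ℂ _ g) = of ℂ _ (MulAut.conjNormal h g) := by
  simp [kerConj]

theorem of_mul_kerIncl (h : H) (a : MonoidAlgebra ℂ j.ker) :
    of ℂ H h * kerIncl j a = kerIncl j (kerConj j h a) * of ℂ H h := by
  induction a using MonoidAlgebra.induction_on with
  | of g => rw [kerIncl_of, kerConj_of, kerIncl_of, ← map_mul, ← map_mul]; simp
  | add a b ha hb => simp only [map_add, mul_add, add_mul, ha, hb]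
  | smul t a ha => simp only [map_smul, mul_smul_comm, smul_mul_assoc, ha]

theorem asAlgebraHom_conjRep {V : Type} [AddCommGroup V] [Module ℂ V]
    (ρ : Representation ℂ j.ker V) (h : H) (a : MonoidAlgebra ℂ j.ker) :
    (conjRep j ρ h).asAlgebraHom a = ρ.asAlgebraHom (kerConj j h a) := by
  induction a using MonoidAlgebra.induction_on with
  | of g => rw [kerConj_of, asAlgebraHom_of, asAlgebraHom_of]; rfl
  | add a b ha hb => simp only [map_add, ha, hb]
  | smul t a ha => simp only [map_smul, ha]

theorem eq_zero_of_sum_kerIncl_mul_of_eq_zero [Fintype Q] {s : Q → H} (hs : ∀ q, j (s q) = q)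
    {y : Q → MonoidAlgebra ℂ j.ker} (h : ∑ q, kerIncl j (y q) * of ℂ H (s q) = 0) : y = 0 := by
  classical
  ext q g
  have h1 := congrArg (fun x => x.coeff (g * s q)) h
  simp only [MonoidAlgebra.coeff_sum, Finsupp.finsetSum_apply, of_apply,
    MonoidAlgebra.coeff_mul_single_apply] at h1
  rw [Finset.sum_eq_single q] at h1
  · simpa [kerIncl, Finsupp.mapDomain_apply j.ker.subtype_injective] using h1
  · intro q' _ hq
    have hg : g * s q * (s q')⁻¹ ∉ Set.range j.ker.subtype := by
      rintro ⟨k, hk⟩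
      have := congrArg j hk
      simp only [Subgroup.subtype_apply, map_mul, map_inv, hs, j.mem_ker.1 k.2, j.mem_ker.1 g.2,
        one_mul] at this
      exact hq (mul_inv_eq_one.1 this.symm).symm
    rw [mul_one]
    exact Finsupp.mapDomain_of_notMem_range _ _ hg
  · simp

end Extension

section GrpdAlg

theorem GrpdAlg.coef_injective {Ghat Q : Type} :
    Function.Injective (GrpdAlg.coef (Ghat := Ghat) (Q := Q)) := by
  rintro ⟨_⟩ ⟨_⟩ rfl
  rfl

variable {Ghat Q : Type} [Fintype Q] [Group Q] {act : Q → Ghat → Ghat}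
  {c : Ghat → Q → Q → ℂ}

variable [Ring (GrpdAlg Ghat Q)]

theorem GrpdAlg.coef_one [DecidableEq Q]
    (hmul : ∀ f₁ f₂ : GrpdAlg Ghat Q, (f₁ * f₂).coef = fun r q =>
      ∑ q₁ : Q, c r q₁ (q₁⁻¹ * q) * f₁.coef r q₁ * f₂.coef (act q₁ r) (q₁⁻¹ * q))
    (hact : ∀ r, act 1 r = r) (hc : ∀ r q, c r 1 q = 1) :
    (1 : GrpdAlg Ghat Q).coef = fun _ q => if q = 1 then 1 else 0 := by
  have h (f : GrpdAlg Ghat Q) : (⟨fun _ q => if q = 1 then 1 else 0⟩ : GrpdAlg Ghat Q) * f = f := by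
    apply GrpdAlg.coef_injective
    ext r q
    rw [hmul]
    simp [hact, hc]
  rw [← h 1, mul_one]

/-- Morita equivalence of an algebra `A` with the twisted groupoid algebra from a family of
elements of `A` multiplying like the basis of the latter and spanning a full corner. -/
theorem moritaEquiv_grpdAlg [Fintype Ghat] [Algebra ℂ (GrpdAlg Ghat Q)]
    (hadd : ∀ f₁ f₂ : GrpdAlg Ghat Q, (f₁ + f₂).coef = fun r q => f₁.coef r q + f₂.coef r q)
    (hsmul : ∀ (a : ℂ) (f : GrpdAlg Ghat Q), (a • f).coef = fun r q => a * f.coef r q)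
    (hmul : ∀ f₁ f₂ : GrpdAlg Ghat Q, (f₁ * f₂).coef = fun r q =>
      ∑ q₁ : Q, c r q₁ (q₁⁻¹ * q) * f₁.coef r q₁ * f₂.coef (act q₁ r) (q₁⁻¹ * q))
    (hact : ∀ r, act 1 r = r) (hc : ∀ r q, c r 1 q = 1)
    {A : Type} [Ring A] [Algebra ℂ A] (β : Ghat → Q → A)
    (hβ : ∀ r q q', β r q * β (act q r) q' = c r q q' • β r (q * q'))
    (hβ_ne : ∀ r q r' q', r' ≠ act q r → β r q * β r' q' = 0)
    (hβ_inj : ∀ t : Ghat → Q → ℂ, ∑ q, ∑ r, t r q • β r q = 0 → t = 0)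
    (hβ_corner : ∀ a r r', β r 1 * a * β r' 1 ∈
      Submodule.span ℂ (Set.range fun p : Ghat × Q => β p.1 p.2))
    {n : Type} [Fintype n] (x y : n → A) (hfull : ∑ i, x i * (∑ r, β r 1) * y i = 1) :
    MoritaEquiv A (GrpdAlg Ghat Q) := by
  classical
  let ι : GrpdAlg Ghat Q →ₗ[ℂ] A :=
    { toFun f := ∑ q, ∑ r, f.coef r q • β r q
      map_add' f g := by simp [hadd, add_smul, Finset.sum_add_distrib]
      map_smul' t f := by simp [hsmul, mul_smul, Finset.smul_sum] }
  have hι (f) : ι f = ∑ q, ∑ r, f.coef r q • β r q := rfl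
  have hι_mul (f g) : ι (f * g) = ι f * ι g := by
    simp only [hι, hmul]
    have h1 (q : Q) (r : Ghat) : (f.coef r q • β r q) * (∑ q', ∑ r', g.coef r' q' • β r' q') =
        ∑ q', (c r q (q⁻¹ * q') * f.coef r q * g.coef (act q r) (q⁻¹ * q')) • β r q' := by
      refine Eq.trans ?_ (Equiv.sum_comp (Equiv.mulLeft q) _)
      rw [Finset.mul_sum]
      refine Finset.sum_congr rfl fun q' _ => ?_
      rw [Finset.mul_sum, Finset.sum_eq_single (act q r)]
      · simp only [Equiv.coe_mulLeft, inv_mul_cancel_left, smul_mul_smul_comm, hβ, smul_smul]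
        congr 1
        ring
      · intro r' _ h
        rw [smul_mul_smul_comm, hβ_ne _ _ _ _ h, smul_zero]
      · simp
    simp only [Finset.sum_mul, h1, Finset.sum_smul]
    rw [Finset.sum_comm, Finset.sum_comm (γ := Q)]
    refine Finset.sum_congr rfl fun r _ => ?_
    rw [Finset.sum_comm]
  have hι_one : ι 1 = ∑ r, β r 1 := by
    rw [hι, GrpdAlg.coef_one hmul hact hc, Finset.sum_eq_single 1]
    · simp
    · intro q _ hq
      simp [hq]
    · simp
  have hι_range : Submodule.span ℂ (Set.range fun p : Ghat × Q => β p.1 p.2) ≤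
      LinearMap.range ι := by
    rw [Submodule.span_le]
    rintro _ ⟨⟨r, q⟩, rfl⟩
    refine ⟨⟨fun r' q' => if q' = q then if r' = r then 1 else 0 else 0⟩, ?_⟩
    rw [hι, Finset.sum_eq_single q, Finset.sum_eq_single r] <;> simp +contextual
  let ι' : GrpdAlg Ghat Q →ₙₐ[ℂ] A :=
    { ι with
      map_zero' := ι.map_zero
      map_mul' := hι_mul }
  refine CornerMorita.moritaEquiv ι' (fun f g h => ?_) (fun a => ?_) x y (by
    simpa only [← hι_one] using! hfull)
  · refine sub_eq_zero.1 (?_ : f - g = 0)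
    have h0 : (f - g).coef = 0 := hβ_inj _ (by
      rw [← hι, map_sub]
      exact sub_eq_zero.2 h)
    apply GrpdAlg.coef_injective
    rw [h0, ← zero_smul ℂ (0 : GrpdAlg Ghat Q), hsmul]
    ext
    simp
  · refine hι_range (?_ : ι 1 * a * ι 1 ∈ _)
    rw [hι_one, Finset.sum_mul, Finset.sum_mul]
    refine Submodule.sum_mem _ fun r _ => ?_
    rw [Finset.mul_sum]
    exact Submodule.sum_mem _ fun r' _ => hβ_corner a r r'

end GrpdAlg

theorem apply_castHom {Ghat : Type} {V : Ghat → Type} [∀ r, AddCommGroup (V r)]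
    [∀ r, Module ℂ (V r)] (ξ : ∀ r, Module.Dual ℂ (V r)) {a b : Ghat} (h : a = b) (v : V a) :
    ξ b (castHom V h v) = ξ a v := by
  subst h
  rfl

theorem tau_one_left {H Q : Type} [Group H] [Group Q] (j : H →* Q) (s : Q → H)
    (hs : ∀ q, j (s q) = q) (hs1 : s 1 = 1) (q : Q) : tau j s hs 1 q = 1 :=
  Subtype.ext <| by simp [tau, hs1]

theorem exists_dual_eq_one {V : Type} [AddCommGroup V] [Module ℂ V] {v : V} (hv : v ≠ 0) :
    ∃ ξ : Module.Dual ℂ V, ξ v = 1 := by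
  obtain ⟨ξ, hξ⟩ := not_forall.1 fun h => hv ((Module.forall_dual_apply_eq_zero_iff ℂ v).1 h)
  exact ⟨(ξ v)⁻¹ • ξ, by simp [hξ]⟩

/-- **Theorem 3.3 / Mackey machine.** The group algebra `ℂH` is Morita
equivalent to the twisted groupoid algebra `C(Ĝ⋊Q, c)`, the algebra with basis
`{([ρ],q)}` and product `([ρ],q)∘([ρ'],q') = c^{[ρ]}(q,q')·([ρ], q q')` if `[ρ'] = q([ρ])`,
and `0` otherwise.  (The twisted groupoid algebra is presented as any ℂ-algebra structure on
`GrpdAlg Ghat Q` whose addition, scalar multiplication and multiplication are the canonical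
ones; on general elements the product is the corresponding twisted convolution.) -/
theorem stmt7 {H Q : Type} [Group H] [Group Q] [Fintype H] [Fintype Q]
    (j : H →* Q) (hj : Function.Surjective j)
    (s : Q → H) (hs : ∀ q, j (s q) = q) (hs1 : s 1 = 1)
    {Ghat : Type} [Fintype Ghat]
    (V : Ghat → Type) [∀ r, AddCommGroup (V r)] [∀ r, Module ℂ (V r)]
    [∀ r, FiniteDimensional ℂ (V r)]
    (ρ : ∀ r, Representation ℂ j.ker (V r))
    (hirr : ∀ r, IsIrredRep (ρ r))
    (hdist : ∀ r r', RepIso (ρ r) (ρ r') → r = r')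
    (hcomplete : ∀ (W : Type) [AddCommGroup W] [Module ℂ W] [FiniteDimensional ℂ W]
      (σ : Representation ℂ j.ker W), IsIrredRep σ → ∃ r, RepIso σ (ρ r))
    (act : Q → Ghat → Ghat)
    (hact : ∀ q r, RepIso (conjRep j (ρ r) (s q)) (ρ (act q r)))
    (hact1 : ∀ r, act 1 r = r)
    (hactmul : ∀ (q₁ q₂ : Q) (r : Ghat), act q₂ (act q₁ r) = act (q₁ * q₂) r)
    (T : ∀ (q : Q) (r : Ghat), V r ≃ₗ[ℂ] V (act q r))
    (hT : ∀ (q : Q) (r : Ghat) (g : j.ker) (v : V r),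
      T q r (conjRep j (ρ r) (s q) g v) = ρ (act q r) g (T q r v))
    (hT1 : ∀ (r : Ghat) (v : V r), T 1 r v = castHom V (hact1 r).symm v)
    (c : Ghat → Q → Q → ℂ)
    (hcdef : ∀ (r : Ghat) (q₁ q₂ : Q) (v : V r),
      T q₂ (act q₁ r) (T q₁ r v) =
        c r q₁ q₂ • castHom V (hactmul q₁ q₂ r).symm
          (T (q₁ * q₂) r (ρ r ((tau j s hs q₁ q₂)⁻¹) v))) :
    ∀ (instR : Ring (GrpdAlg Ghat Q)) (instA : Algebra ℂ (GrpdAlg Ghat Q)),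
      (∀ f₁ f₂ : GrpdAlg Ghat Q, (f₁ + f₂).coef = fun r q => f₁.coef r q + f₂.coef r q) →
      (∀ (a : ℂ) (f : GrpdAlg Ghat Q), (a • f).coef = fun r q => a * f.coef r q) →
      (∀ f₁ f₂ : GrpdAlg Ghat Q, (f₁ * f₂).coef = fun r q =>
        ∑ q₁ : Q, c r q₁ (q₁⁻¹ * q) * f₁.coef r q₁ * f₂.coef (act q₁ r) (q₁⁻¹ * q)) →
      MoritaEquiv (MonoidAlgebra ℂ H) (GrpdAlg Ghat Q) := by
  intro instR instA hadd hsmul hmul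
  have hfin : Finite j.ker := inferInstance
  obtain ⟨E⟩ := RankOneSystem.nonempty_of_irreducible hirr hdist hcomplete
  choose v hv using fun r => have := (hirr r).1; exists_ne (0 : V r)
  choose ξ hξ using fun r => exists_dual_eq_one (hv r)
  let ℓ (r : Ghat) (q : Q) : Module.Dual ℂ (V r) := ξ (act q r) ∘ₗ (T q r).toLinearMap
  have hℓ_one (r) : ℓ r 1 = ξ r := LinearMap.ext fun w => by
    change ξ _ (T 1 r w) = _
    rw [hT1, apply_castHom]
  have hℓ_ne (r q) : ℓ r q ≠ 0 := fun h => by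
    have := LinearMap.congr_fun h ((T q r).symm (v (act q r)))
    simp [ℓ, hξ] at this
  have hℓ (r q q' w) :
      ℓ (act q r) q' (T q r w) = c r q q' * ℓ r (q * q') (ρ r (tau j s hs q q')⁻¹ w) := by
    change ξ _ (T q' (act q r) (T q r w)) = c r q q' * ξ _ (T (q * q') r _)
    rw [hcdef, map_smul, apply_castHom, smul_eq_mul]
  have hc (r q) : c r 1 q = 1 := by
    have h := hℓ r 1 q ((T q r).symm (v (act q r)))
    rw [hT1, apply_castHom (fun r => ℓ r q), tau_one_left j s hs hs1, one_mul] at h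
    simpa [ℓ, hξ] using h.symm
  have hact_inj {q r r'} (h : act q r = act q r') : r = r' := by
    rw [← hact1 r, ← hact1 r', ← mul_inv_cancel q, ← hactmul, ← hactmul, h]
  have hact_inv (q r) : act q (act q⁻¹ r) = r := by rw [hactmul, inv_mul_cancel, hact1]
  have hTa (q r a w) : T q r ((ρ r).asAlgebraHom (kerConj j (s q) a) w) =
      (ρ (act q r)).asAlgebraHom a (T q r w) := by
    rw [← asAlgebraHom_conjRep]
    exact apply_asAlgebraHom (T q r).toLinearMap (hT q r) a w
  have hconj (q r x η) : kerConj j (s q) (E.elt (act q r) x η) =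
      E.elt r ((T q r).symm x) (η ∘ₗ (T q r).toLinearMap) := by
    refine E.ext_act fun r' w => (T q r').injective ?_
    rw [hTa]
    by_cases h : r' = r
    · subst h
      simp [E.act_self]
    · simp [E.act_ne _ _ _ _ h, E.act_ne _ _ _ _ (mt hact_inj h)]
  have hmove (q r x η) : of ℂ H (s q) * kerIncl j (E.elt (act q r) x η) =
      kerIncl j (E.elt r ((T q r).symm x) (η ∘ₗ (T q r).toLinearMap)) * of ℂ H (s q) := by
    rw [of_mul_kerIncl, hconj]
  have hs_mul (q q') : of ℂ H (s q) * of ℂ H (s q') =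
      kerIncl j (of ℂ _ (tau j s hs q q')) * of ℂ H (s (q * q')) := by
    rw [kerIncl_of, ← map_mul, ← map_mul]
    simp [tau]
  let β (r : Ghat) (q : Q) : MonoidAlgebra ℂ H :=
    kerIncl j (E.elt r (v r) (ℓ r q)) * of ℂ H (s q)
  have hβ_def (r q) : β r q = kerIncl j (E.elt r (v r) (ℓ r q)) * of ℂ H (s q) := rfl
  have hβ_one (r) : β r 1 = kerIncl j (E.elt r (v r) (ξ r)) := by
    rw [hβ_def, hs1, hℓ_one, map_one, mul_one]
  have hβ_mul (r q r' x η) : β r q * kerIncl j (E.elt (act q r') x η) =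
      kerIncl j (E.elt r (v r) (ℓ r q) *
        E.elt r' ((T q r').symm x) (η ∘ₗ (T q r').toLinearMap)) * of ℂ H (s q) := by
    rw [hβ_def, mul_assoc, hmove, map_mul, mul_assoc]
  refine moritaEquiv_grpdAlg hadd hsmul hmul hact1 hc β ?_ ?_ ?_ ?_
    (n := Σ r, Fin (Module.finrank ℂ (V r)))
    (fun i => kerIncl j (E.elt i.1 (Module.finBasis ℂ (V i.1) i.2) (ξ i.1)))
    (fun i => kerIncl j (E.elt i.1 (v i.1) ((Module.finBasis ℂ (V i.1)).coord i.2))) ?_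
  · intro r q q'
    rw [hβ_def (act q r), ← mul_assoc, hβ_mul, E.elt_mul_elt, mul_assoc, hs_mul, ← mul_assoc,
      ← map_mul, smul_mul_assoc, E.elt_mul, asAlgebraHom_of, hβ_def, ← smul_mul_assoc, ← map_smul,
      E.smul_elt, E.smul_elt]
    congr 3
    ext w
    have h := hℓ r q q' (ρ r (tau j s hs q q') w)
    rw [← Module.End.mul_apply, ← map_mul, inv_mul_cancel, map_one, Module.End.one_apply] at h
    simpa [ℓ, hξ] using h
  · intro r q r' q' h
    obtain ⟨r', rfl⟩ : ∃ r'', act q r'' = r' := ⟨_, hact_inv q r'⟩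
    rw [hβ_def (act q r'), ← mul_assoc, hβ_mul,
      E.elt_mul_elt_of_ne (fun hr => h (congrArg (act q) hr.symm))]
    simp
  · intro t ht
    have h := eq_zero_of_sum_kerIncl_mul_of_eq_zero j hs
      (y := fun q => ∑ r, t r q • E.elt r (v r) (ℓ r q)) (by
        rw [← ht]
        simp only [hβ_def, map_sum, map_smul, Finset.sum_mul, smul_mul_assoc])
    ext r q
    exact congrFun (E.eq_zero_of_sum_smul_elt_eq_zero (fun r => t r q) v (fun r => ℓ r q) hv
      (fun r => hℓ_ne r q) (congrFun h q)) r
  · intro a r r'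
    induction a using MonoidAlgebra.induction_on with
    | add a b ha hb =>
      rw [mul_add, add_mul]
      exact Submodule.add_mem _ ha hb
    | smul t a ha =>
      rw [mul_smul_comm, smul_mul_assoc]
      exact Submodule.smul_mem _ t ha
    | of h =>
      obtain ⟨q, g, rfl⟩ : ∃ (q : Q) (g : j.ker), h = g * s q :=
        ⟨j h, ⟨h * (s (j h))⁻¹, by simp [MonoidHom.mem_ker, hs]⟩, by simp⟩
      obtain ⟨r', rfl⟩ : ∃ r'', act q r'' = r' := ⟨_, hact_inv q r'⟩
      rw [map_mul, ← kerIncl_of, hβ_one, hβ_one, ← mul_assoc, mul_assoc, hmove, ← mul_assoc,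
        ← map_mul, ← map_mul, E.elt_mul]
      by_cases hr : r = r'
      · subst hr
        rw [E.elt_mul_elt, map_smul, smul_mul_assoc]
        exact Submodule.smul_mem _ _ (Submodule.subset_span ⟨(r, q), rfl⟩)
      · rw [E.elt_mul_elt_of_ne hr]
        simp
  · have h (i : Σ r, Fin (Module.finrank ℂ (V r))) :
        kerIncl j (E.elt i.1 (Module.finBasis ℂ (V i.1) i.2) (ξ i.1)) * (∑ r, β r 1) *
          kerIncl j (E.elt i.1 (v i.1) ((Module.finBasis ℂ (V i.1)).coord i.2)) =
        kerIncl j (E.elt i.1 (Module.finBasis ℂ (V i.1) i.2)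
          ((Module.finBasis ℂ (V i.1)).coord i.2)) := by
      simp only [hβ_one, ← map_sum, ← map_mul]
      rw [Finset.mul_sum, Finset.sum_eq_single i.1]
      · rw [E.elt_mul_elt, hξ, one_smul, E.elt_mul_elt, hξ, one_smul]
      · intro r _ hr
        exact E.elt_mul_elt_of_ne hr.symm _ _ _ _
      · simp
    rw [Finset.sum_congr rfl fun i _ => h i, ← map_sum,
      E.sum_elt_basis fun r => Module.finBasis ℂ (V r), map_one]
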